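/- For every real y > 0, one has −∑_{n≥1} log(1 − e^{−2π n y}) − π/(12 y) = −∑_{n≥1} log(1 − e^{−2π n / y}) − π y / 12 + (1/2) log y. -/

import Mathlib

open Real

/-- The logarithm of the Dedekind eta function on the imaginary axis. -/
theorem log_norm_eta_I_mul {t : ℝ} (ht : 0 < t) :
    Real.log ‖ModularForm.eta (Complex.I * t)‖ =
      -(π * t / 12) + ∑' n : ℕ, Real.log (1 - Real.exp (-2 * π * ((n : ℝ) + 1) * t)) := by
  have hz : Complex.I * t ∈ UpperHalfPlane.upperHalfPlaneSet := by
    simpa [UpperHalfPlane.upperHalfPlaneSet] using ht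
  have hterm (n : ℕ) : 1 + -ModularForm.eta_q n (Complex.I * t) =
      ((1 - Real.exp (-2 * π * ((n : ℝ) + 1) * t) : ℝ) : ℂ) := by
    rw [ModularForm.eta_q_eq_cexp]
    push_cast
    rw [sub_eq_add_neg]
    congr 3
    linear_combination (2 * (π : ℂ) * (n + 1) * t) * Complex.I_mul_I
  have hne (n : ℕ) : 1 + -ModularForm.eta_q n (Complex.I * t) ≠ 0 := by
    simpa [sub_eq_add_neg] using ModularForm.one_sub_eta_q_ne_zero n hz
  have hsum := ModularForm.summable_eta_q ⟨Complex.I * t, hz⟩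
  have hprod : Real.log ‖∏' n, (1 + -ModularForm.eta_q n (Complex.I * t))‖ =
      ∑' n : ℕ, Real.log (1 - Real.exp (-2 * π * ((n : ℝ) + 1) * t)) := by
    rw [(multipliable_one_add_of_summable hsum).norm_tprod,
      ← Real.rexp_tsum_eq_tprod (fun n ↦ norm_pos_iff.mpr (hne n)) hsum.summable_log_norm_one_add,
      Real.log_exp]
    refine tsum_congr fun n ↦ ?_
    rw [hterm, Complex.norm_real, Real.norm_eq_abs, Real.log_abs]
  simp only [← sub_eq_add_neg] at hprod
  rw [ModularForm.eta, norm_mul, Real.log_mul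
    (norm_ne_zero_iff.mpr (Function.Periodic.qParam_ne_zero _))
    (norm_ne_zero_iff.mpr (ModularForm.eta_tprod_ne_zero hz)), hprod,
    Function.Periodic.norm_qParam, Real.log_exp]
  simp
  ring

/-- The logarithm of the norm of the principal complex square root. -/
theorem Complex.log_norm_sqrt {z : ℂ} (hz : z ≠ 0) :
    Real.log ‖Complex.sqrt z‖ = Real.log ‖z‖ / 2 := by
  rw [_root_.sqrt_eq_exp hz, Complex.norm_exp, Real.log_exp]
  simp [Complex.log_re]

/-- The logarithmic form of the Dedekind eta transformation law. -/
theorem log_eta_transformation (y : ℝ) (hy : 0 < y) :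
    -(∑' n : ℕ, Real.log (1 - Real.exp (-2 * π * ((n : ℝ) + 1) * y))) - π / (12 * y) =
      -(∑' n : ℕ, Real.log (1 - Real.exp (-2 * π * ((n : ℝ) + 1) / y))) - π * y / 12 +
        1 / 2 * Real.log y := by
  have hz : Complex.I * y ∈ UpperHalfPlane.upperHalfPlaneSet := by
    simpa [UpperHalfPlane.upperHalfPlaneSet] using hy
  have hyC : (y : ℂ) ≠ 0 := by exact_mod_cast hy.ne'
  have hz0 : Complex.I * y ≠ 0 := mul_ne_zero Complex.I_ne_zero hyC
  have hinv : -1 / (Complex.I * y) = Complex.I * (y⁻¹ : ℝ) := by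
    push_cast
    field_simp
    simp
  have key := congrArg (fun w ↦ Real.log ‖w‖) (ModularForm.eta_comp_eq_csqrt_I_inv hz)
  have hsqrt {z : ℂ} (hz : z ≠ 0) : ‖Complex.sqrt z‖ ≠ 0 := by
    simp [_root_.sqrt_eq_exp hz]
  simp only [Function.comp_apply, Pi.smul_apply, Pi.mul_apply, smul_eq_mul, norm_mul, norm_inv,
    hinv] at key
  rw [Real.log_mul (inv_ne_zero (hsqrt Complex.I_ne_zero))
      (mul_ne_zero (hsqrt hz0) (norm_ne_zero_iff.mpr (ModularForm.eta_ne_zero hz))),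
    Real.log_mul (hsqrt hz0) (norm_ne_zero_iff.mpr (ModularForm.eta_ne_zero hz)), Real.log_inv,
    Complex.log_norm_sqrt Complex.I_ne_zero, Complex.log_norm_sqrt hz0,
    log_norm_eta_I_mul hy, log_norm_eta_I_mul (inv_pos.mpr hy)] at key
  simp only [norm_mul, Complex.norm_I, Complex.norm_real, Real.norm_eq_abs, one_mul, Real.log_abs,
    Real.log_one, ← div_eq_mul_inv] at key
  rw [show π / (12 * y) = π / y / 12 by field_simp]
  linarith
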